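/- Let x ∈ D ⊆ 𝒟 with E_f(x) ∈ J satisfy ‖x − T(x)‖ ⪯ γ(E_f(x))·‖W_f(x)‖ and ‖W_f(T(x))‖ ⪯ β(E_f(x))·‖W_f(x)‖, where γ : J → ℝ₊ is such that ψ(t) = 1 − b·t·γ(t) is positive on J and β : J → [0,1). Then E_f(T(x)) ≤ φ(E_f(x)), where φ(t) = t·β(t)/ψ(t). (Theorem 2.1 (viii)) -/

import Mathlib

open Finset Polynomial Filter

noncomputable section

/-- The Weierstrass correction `W_i(x) = f(x_i)/(C₀ ∏_{j≠i}(x_i − x_j))`. -/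
def Wc {n : ℕ} {K : Type*} [NormedField K] (f : Polynomial K) (x : Fin n → K) (i : Fin n) : K :=
  eval (x i) f / (f.leadingCoeff * ∏ j ∈ univ.erase i, (x i - x j))

/-- `dmin x i = min_{j ≠ i} ‖x i - x j‖`. -/
def dmin {n : ℕ} {K : Type*} [NormedField K] (x : Fin n → K) (i : Fin n) : ℝ :=
  if h : (univ.erase i).Nonempty then (univ.erase i).inf' h fun j => ‖x i - x j‖ else 0

/-- `E_f(x)` : the ℓ^p norm of the vector `(‖W_i(x)‖ / d_i(x))_i`. -/
def Ef {n : ℕ} {K : Type*} [NormedField K] (p : ENNReal) (f : Polynomial K)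
    (x : Fin n → K) : ℝ :=
  ‖(WithLp.equiv p (Fin n → ℝ)).symm (fun i => ‖Wc f x i‖ / dmin x i)‖

/-- `σ_i(x) = Σ_{j≠i} W_j(x)/(x_i − x_j)`. -/
def sigmaf {n : ℕ} {K : Type*} [NormedField K] (f : Polynomial K) (x : Fin n → K)
    (i : Fin n) : K :=
  ∑ j ∈ univ.erase i, Wc f x j / (x i - x j)

/-- The Ehrlich iteration function. -/
def PhiE {n : ℕ} {K : Type*} [NormedField K] (f : Polynomial K) (x : Fin n → K) : Fin n → K :=
  fun i => x i - Wc f x i / (1 + sigmaf f x i)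

/-- The Prešić–Tanabe iteration function. -/
def TnbE {n : ℕ} {K : Type*} [NormedField K] (f : Polynomial K) (x : Fin n → K) : Fin n → K :=
  fun i => x i - Wc f x i * (1 - sigmaf f x i)

/-- `ξ` is a root vector of `f`, i.e. `f(z) = C₀ ∏ (z − ξᵢ)`. -/
def IsRootVector {n : ℕ} {K : Type*} [NormedField K] (f : Polynomial K) (ξ : Fin n → K) : Prop :=
  f = C f.leadingCoeff * ∏ i, (X - C (ξ i))

/-- `E_f(x)` in the case `p = ∞`: the max of `‖W_i(x)‖ / d_i(x)`. -/
def Einf {n : ℕ} {K : Type*} [NormedField K] (f : Polynomial K) (x : Fin n → K) : ℝ :=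
  if h : (univ : Finset (Fin n)).Nonempty then univ.sup' h fun i => ‖Wc f x i‖ / dmin x i else 0

theorem add_rpow_le_two_rpow_mul {r s t : ℝ} (hr : 1 ≤ r) (hs : 0 ≤ s) (ht : 0 ≤ t) :
    (s + t) ^ r ≤ 2 ^ (r - 1) * (s ^ r + t ^ r) := by
  lift s to NNReal using hs
  lift t to NNReal using ht
  exact_mod_cast NNReal.rpow_add_le_mul_rpow_add_rpow s t hr

theorem norm_toLp_eq_rpow {ι : Type*} [Fintype ι] {p : ENNReal} (hp : 1 ≤ p) (hp' : p ≠ ⊤)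
    (u : ι → ℝ) (hu : ∀ i, 0 ≤ u i) :
    ‖WithLp.toLp p u‖ = (∑ i, u i ^ p.toReal) ^ (1 / p.toReal) := by
  have hp0 : 0 < p.toReal := ENNReal.toReal_pos (by positivity) hp'
  simp [PiLp.norm_eq_sum hp0, abs_of_nonneg (hu _)]

theorem norm_toLp_mono {ι : Type*} [Fintype ι] {p : ENNReal} (hp : 1 ≤ p)
    {u v : ι → ℝ} (hu : ∀ i, 0 ≤ u i) (huv : ∀ i, u i ≤ v i) :
    ‖WithLp.toLp p u‖ ≤ ‖WithLp.toLp p v‖ := by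
  by_cases hp' : p = ⊤
  · subst hp'
    rw [PiLp.norm_toLp, PiLp.norm_toLp]
    refine (pi_norm_le_iff_of_nonneg (norm_nonneg _)).2 fun i => ?_
    refine le_trans ?_ (norm_le_pi_norm v i)
    exact abs_le_abs_of_nonneg (hu i) (huv i)
  · rw [norm_toLp_eq_rpow hp hp' u hu,
      norm_toLp_eq_rpow hp hp' v fun i => (hu i).trans (huv i)]
    gcongr with i
    · exact Finset.sum_nonneg fun i _ => Real.rpow_nonneg (hu i) _
    · exact hu i
    · exact huv i

/-- Hölder's inequality for the sum of two distinct coordinates. -/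
theorem add_le_two_rpow_mul_norm_toLp {ι : Type*} [Fintype ι] {p q : ENNReal} (hp : 1 ≤ p)
    (hpq : p⁻¹ + q⁻¹ = 1) (u : ι → ℝ) (hu : ∀ i, 0 ≤ u i) {i j : ι} (hij : i ≠ j) :
    u i + u j ≤ 2 ^ (q⁻¹).toReal * ‖WithLp.toLp p u‖ := by
  classical
  by_cases hp' : p = ⊤
  · subst hp'
    have hq : q⁻¹ = 1 := by simpa using hpq
    rw [PiLp.norm_toLp, hq]
    have hi := (le_abs_self _).trans (norm_le_pi_norm u i)
    have hj := (le_abs_self _).trans (norm_le_pi_norm u j)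
    simp only [ENNReal.toReal_one, Real.rpow_one]
    linarith
  · have hp1 : 1 ≤ p.toReal := by
      simpa using ENNReal.toReal_mono hp' hp
    have hp0 : 0 < p.toReal := by linarith
    have hq : (q⁻¹).toReal = (p.toReal - 1) * (1 / p.toReal) := by
      have hqt : q⁻¹ ≠ ⊤ := by
        intro h
        simp [h] at hpq
      have hpt : p⁻¹ ≠ ⊤ := by
        intro h
        simp [h] at hpq
      have h := congrArg ENNReal.toReal hpq
      rw [ENNReal.toReal_add hpt hqt, ENNReal.toReal_inv p, ENNReal.toReal_one] at h
      have h2 : (q⁻¹).toReal = 1 - p.toReal⁻¹ := by linarith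
      rw [h2]
      field_simp
    have hsum : u i ^ p.toReal + u j ^ p.toReal ≤ ∑ k, u k ^ p.toReal := by
      rw [← Finset.sum_pair (f := fun k => u k ^ p.toReal) hij]
      exact Finset.sum_le_sum_of_subset_of_nonneg (Finset.subset_univ _)
        fun k _ _ => Real.rpow_nonneg (hu k) _
    have hS : 0 ≤ ∑ k, u k ^ p.toReal := Finset.sum_nonneg fun k _ => Real.rpow_nonneg (hu k) _
    have hpow : (u i + u j) ^ p.toReal ≤ 2 ^ (p.toReal - 1) * ∑ k, u k ^ p.toReal :=
      (add_rpow_le_two_rpow_mul hp1 (hu i) (hu j)).trans (by gcongr)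
    rw [norm_toLp_eq_rpow hp hp' u hu, hq, Real.rpow_mul (by norm_num),
      ← Real.mul_rpow (by positivity) hS, one_div,
      Real.le_rpow_inv_iff_of_pos (add_nonneg (hu i) (hu j)) (by positivity) hp0]
    exact hpow

theorem dmin_eq_inf' {n : ℕ} {K : Type*} [NormedField K] (hn : 2 ≤ n) (x : Fin n → K)
    (i : Fin n) :
    ∃ h : (univ.erase i).Nonempty, dmin x i = (univ.erase i).inf' h fun j => ‖x i - x j‖ := by
  have h : (univ.erase i).Nonempty := by
    rw [← Finset.card_pos, Finset.card_erase_of_mem (mem_univ i), Finset.card_fin]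
    omega
  exact ⟨h, dif_pos h⟩

theorem dmin_le {n : ℕ} {K : Type*} [NormedField K] (x : Fin n → K) {i j : Fin n}
    (hij : j ≠ i) : dmin x i ≤ ‖x i - x j‖ := by
  have hj : j ∈ univ.erase i := by simp [hij]
  rw [dmin, dif_pos ⟨j, hj⟩]
  exact Finset.inf'_le _ hj

theorem le_dmin {n : ℕ} {K : Type*} [NormedField K] (hn : 2 ≤ n) (x : Fin n → K) {i : Fin n}
    {c : ℝ} (hc : ∀ j, j ≠ i → c ≤ ‖x i - x j‖) : c ≤ dmin x i := by
  obtain ⟨h, hd⟩ := dmin_eq_inf' hn x i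
  rw [hd]
  exact Finset.le_inf' _ _ fun j hj => hc j (Finset.ne_of_mem_erase hj)

theorem dmin_pos {n : ℕ} {K : Type*} [NormedField K] (hn : 2 ≤ n) {x : Fin n → K}
    (hx : Function.Injective x) (i : Fin n) : 0 < dmin x i := by
  obtain ⟨h, hd⟩ := dmin_eq_inf' hn x i
  rw [hd, Finset.lt_inf'_iff]
  intro j hj
  exact norm_pos_iff.2 (sub_ne_zero.2 (hx.ne (Finset.ne_of_mem_erase hj).symm))

/-- The minimal separation shrinks by at most the factor `1 - g * s` under a perturbation whose
size is controlled by `g * ‖W‖`. -/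
theorem mul_dmin_le_dmin {n : ℕ} {K : Type*} [NormedField K] (hn : 2 ≤ n) {x y : Fin n → K}
    (hx : Function.Injective x) {w : Fin n → ℝ} {g s : ℝ} (hg : 0 ≤ g) (hw : ∀ i, 0 ≤ w i)
    (hs : ∀ i j, i ≠ j → w i / dmin x i + w j / dmin x j ≤ s) (hgs : 0 ≤ 1 - s * g)
    (hxy : ∀ i, ‖x i - y i‖ ≤ g * w i) (i : Fin n) :
    (1 - s * g) * dmin x i ≤ dmin y i := by
  refine le_dmin hn y fun j hji => ?_
  have bound : ∀ k, dmin x k ≤ ‖x i - x j‖ → w k ≤ w k / dmin x k * ‖x i - x j‖ := fun k hk =>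
    calc w k = w k / dmin x k * dmin x k := (div_mul_cancel₀ _ (dmin_pos hn hx k).ne').symm
      _ ≤ _ := mul_le_mul_of_nonneg_left hk (div_nonneg (hw k) (dmin_pos hn hx k).le)
  have hi := bound i (dmin_le x hji)
  have hj := bound j (by rw [norm_sub_rev]; exact dmin_le x hji.symm)
  have hsum : w i + w j ≤ s * ‖x i - x j‖ := by
    have := mul_le_mul_of_nonneg_right (hs i j hji.symm) (norm_nonneg (x i - x j))
    linarith
  have htri : ‖x i - x j‖ ≤ ‖x i - y i‖ + ‖y i - y j‖ + ‖x j - y j‖ := by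
    have h : x i - x j = (x i - y i) + (y i - y j) - (x j - y j) := by ring
    rw [h]
    exact (norm_sub_le _ _).trans (add_le_add_left (norm_add_le _ _) _)
  have hd := mul_le_mul_of_nonneg_left (dmin_le x hji) hgs
  have hgsum := mul_le_mul_of_nonneg_left hsum hg
  linarith [hxy i, hxy j]

/-- Proinov, Theorem 2.1 (viii). -/
theorem stmt_5 {n : ℕ} {K : Type*} [NormedField K] [CompleteSpace K] (hn : 2 ≤ n)
    (f : Polynomial K) (hdeg : f.degree = (n : ℕ))
    (p q : ENNReal) (hp : 1 ≤ p) (hpq : p⁻¹ + q⁻¹ = 1)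
    (b : ℝ) (hb : b = (2 : ℝ) ^ (ENNReal.toReal q⁻¹))
    (J : Set ℝ) (hJ0 : (0 : ℝ) ∈ J) (hJsub : J ⊆ Set.Ici (0 : ℝ)) (hJconn : J.OrdConnected)
    (γ : ℝ → ℝ) (hγ : ∀ t ∈ J, 0 ≤ γ t) (hψ : ∀ t ∈ J, 0 < 1 - b * t * γ t)
    (β : ℝ → ℝ) (hβ : ∀ t ∈ J, 0 ≤ β t ∧ β t < 1)
    (D : Set (Fin n → K)) (hD : ∀ y ∈ D, Function.Injective y)
    (T : (Fin n → K) → Fin n → K)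
    (x : Fin n → K) (hxD : x ∈ D) (hxE : Ef p f x ∈ J)
    (hmain : ∀ i, ‖x i - T x i‖ ≤ γ (Ef p f x) * ‖Wc f x i‖)
    (hW : ∀ i, ‖Wc f (T x) i‖ ≤ β (Ef p f x) * ‖Wc f x i‖) :
    Ef p f (T x) ≤ Ef p f x * β (Ef p f x) / (1 - b * Ef p f x * γ (Ef p f x)) := by
  set E := Ef p f x
  set u : Fin n → ℝ := fun i => ‖Wc f x i‖ / dmin x i
  have hx := hD x hxD
  have hu : ∀ i, 0 ≤ u i := fun i => div_nonneg (norm_nonneg _) (dmin_pos hn hx i).le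
  have hψE := hψ E hxE
  have hβE := (hβ E hxE).1
  have hd : ∀ i, (1 - b * E * γ E) * dmin x i ≤ dmin (T x) i :=
    mul_dmin_le_dmin hn hx (hγ E hxE) (fun i => norm_nonneg _)
      (fun i j hij => hb ▸ add_le_two_rpow_mul_norm_toLp hp hpq u hu hij) hψE.le hmain
  have hdx := dmin_pos hn hx
  have hc : 0 ≤ β E / (1 - b * E * γ E) := div_nonneg hβE hψE.le
  have hcomp : ∀ i, ‖Wc f (T x) i‖ / dmin (T x) i ≤ (β E / (1 - b * E * γ E) * u i) := by
    intro i
    calc ‖Wc f (T x) i‖ / dmin (T x) i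
        ≤ (β E * ‖Wc f x i‖) / ((1 - b * E * γ E) * dmin x i) :=
          div_le_div₀ (mul_nonneg hβE (norm_nonneg _)) (hW i) (mul_pos hψE (hdx i)) (hd i)
      _ = _ := mul_div_mul_comm _ _ _ _
  have : Fact (1 ≤ p) := ⟨hp⟩
  calc Ef p f (T x)
      ≤ ‖WithLp.toLp p ((β E / (1 - b * E * γ E)) • u)‖ :=
        norm_toLp_mono hp
          (fun i => div_nonneg (norm_nonneg _) ((mul_pos hψE (hdx i)).le.trans (hd i))) hcomp
    _ = β E / (1 - b * E * γ E) * E := by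
        rw [WithLp.toLp_smul, norm_smul, Real.norm_of_nonneg hc]
        rfl
    _ = E * β E / (1 - b * E * γ E) := by ring
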